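/- arXiv:1907.11288 — 4 statements merged into one kernel-verified Lean document; each statement's English description precedes it below -/
import Mathlib

section
/- Let R be a commutative domain and n > 1, and let A = M_n(R) be the algebra of n×n matrices over R. Then R is infinite if and only if there is no nonzero polynomial g ∈ R[X] such that g(ab) = 0 for all a, b ∈ A with a² = 0 and b² = 0. -/
open Polynomial in
/-- Evaluating a polynomial at a diagonal matrix evaluates it at every diagonal entry. -/
theorem Matrix.aeval_diagonal_apply_self {R ι : Type*} [CommSemiring R] [Fintype ι]
    [DecidableEq ι] (g : R[X]) (d : ι → R) (i : ι) :
    aeval (Matrix.diagonal d) g i i = g.eval (d i) := by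
  have h := aeval_algHom_apply (Matrix.diagonalAlgHom (n := ι) (α := R) R) d g
  rw [Matrix.diagonalAlgHom_apply, Matrix.diagonalAlgHom_apply] at h
  rw [h, Matrix.diagonal_apply_eq, ← coe_aeval_eq_eval]
  exact (aeval_algHom_apply (Pi.evalAlgHom R (fun _ : ι => R) i) d g).symm

open Polynomial in
/-- The square matrices over a finite commutative ring have a common monic annihilator. -/
theorem Matrix.exists_monic_forall_aeval_eq_zero (R ι : Type*) [CommRing R] [Finite R]
    [Fintype ι] [DecidableEq ι] :
    ∃ g : R[X], g.Monic ∧ ∀ M : Matrix ι ι R, aeval M g = 0 := by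
  classical
  have := Fintype.ofFinite (Matrix ι ι R)
  refine ⟨∏ M : Matrix ι ι R, M.charpoly,
    monic_prod_of_monic _ _ fun M _ => M.charpoly_monic, fun M => ?_⟩
  rw [← Finset.mul_prod_erase _ _ (Finset.mem_univ M), map_mul, M.aeval_self_charpoly, zero_mul]

/-- **Lemma.** Let `R` be a commutative domain, `n > 1` and `A = M_n(R)`.  Then `R`
is infinite if and only if there is no nonzero polynomial `g ∈ R[X]` such that
`g(ab) = 0` for all `a, b ∈ A` with `a² = b² = 0`. -/
theorem matrix_infinite_iff_no_annihilating_poly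
    {R : Type*} [CommRing R] [IsDomain R] (n : ℕ) (hn : 1 < n) :
    Infinite R ↔
      ¬ ∃ g : Polynomial R, g ≠ 0 ∧
        ∀ a b : Matrix (Fin n) (Fin n) R, a ^ 2 = 0 → b ^ 2 = 0 →
          Polynomial.aeval (a * b) g = 0 := by
  constructor
  · rintro _ ⟨g, hg, h⟩
    refine hg (Polynomial.funext fun r => ?_)
    let i : Fin n := ⟨0, by omega⟩
    let j : Fin n := ⟨1, hn⟩
    have hij : i ≠ j := by simp [i, j]
    have key := h (Matrix.single i j r) (Matrix.single j i 1)
      (by rw [sq, Matrix.single_mul_single_of_ne _ _ _ _ hij.symm])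
      (by rw [sq, Matrix.single_mul_single_of_ne _ _ _ _ hij])
    rw [Matrix.single_mul_single_same, mul_one, ← Matrix.diagonal_single] at key
    simpa [key] using (Matrix.aeval_diagonal_apply_self g (Pi.single i r) i).symm
  · intro h
    by_contra hR
    have := not_infinite_iff_finite.mp hR
    obtain ⟨g, hg, hg0⟩ := Matrix.exists_monic_forall_aeval_eq_zero R (Fin n)
    exact h ⟨g, hg.ne_zero, fun a b _ _ => hg0 (a * b)⟩
end

section
/- Let R be an infinite commutative domain and let F = R⟨x, y⟩/(x², y²) be the quotient of the free associative unital R-algebra on two generators x, y by the two-sided ideal generated by x² and y². Then for every n ≥ 2 and every k, every polynomial identity of M_n(R) in k noncommuting variables is also a polynomial identity of F: if p is an element of the free R-algebra R⟨x_1,…,x_k⟩ with p(A_1,…,A_k) = 0 for all A_1,…,A_k ∈ M_n(R), then p(u_1,…,u_k) = 0 for all u_1,…,u_k ∈ F. -/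
open scoped BigOperators

/-- The relation on the free associative unital `R`-algebra on two generators `x, y`
identifying `x²` and `y²` with `0`; the corresponding `RingQuot` is the quotient
`F = R⟨x, y⟩/(x², y²)` by the two-sided ideal generated by `x²` and `y²`. -/
def sqRel (R : Type*) [CommRing R] :
    FreeAlgebra R (Fin 2) → FreeAlgebra R (Fin 2) → Prop := fun a b =>
  (a = FreeAlgebra.ι R (0 : Fin 2) ^ 2 ∧ b = 0) ∨
  (a = FreeAlgebra.ι R (1 : Fin 2) ^ 2 ∧ b = 0)

section AlternatingForm

open Polynomial

variable {R A : Type*} [CommRing R] [Ring A] [Algebra R A]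

/-- The combination `c + a(xy) x + b(yx) y + d(xy) xy + e(yx) yx` of alternating words in
`x` and `y`. -/
noncomputable def alternatingForm (x y : A) (c : R) (a b d e : R[X]) : A :=
  algebraMap R A c + aeval (x * y) a * x + aeval (y * x) b * y +
    aeval (x * y) d * (x * y) + aeval (y * x) e * (y * x)

theorem alternatingForm_swap (x y : A) (c : R) (a b d e : R[X]) :
    alternatingForm y x c b a e d = alternatingForm x y c a b d e := by
  simp only [alternatingForm]
  abel

theorem alternatingForm_add (x y : A) (c c' : R) (a b d e a' b' d' e' : R[X]) :
    alternatingForm x y (c + c') (a + a') (b + b') (d + d') (e + e') =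
      alternatingForm x y c a b d e + alternatingForm x y c' a' b' d' e' := by
  simp only [alternatingForm, map_add, add_mul]
  abel

theorem alternatingForm_C_mul (x y : A) (r c : R) (a b d e : R[X]) :
    alternatingForm x y (r * c) (C r * a) (C r * b) (C r * d) (C r * e) =
      algebraMap R A r * alternatingForm x y c a b d e := by
  simp only [alternatingForm, map_mul, mul_add, aeval_C, mul_assoc]

theorem mul_aeval_mul_swap (x y : A) (a : R[X]) :
    x * aeval (y * x) a = aeval (x * y) a * x := by
  induction a using Polynomial.induction_on' with
  | add p q hp hq => simp only [map_add, mul_add, add_mul, hp, hq]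
  | monomial n r =>
    have h : SemiconjBy x ((y * x) ^ n) ((x * y) ^ n) :=
      SemiconjBy.pow_right (mul_assoc x y x).symm n
    rw [aeval_monomial, aeval_monomial, ← mul_assoc, ← Algebra.commutes, mul_assoc, h.eq,
      mul_assoc]

theorem mul_alternatingForm_left {x : A} (hx : x * x = 0) (y : A) (c : R) (a b d e : R[X]) :
    x * alternatingForm x y c a b d e = alternatingForm x y 0 (C c + e * X) 0 b 0 := by
  have ha : x * (aeval (x * y) a * x) = 0 := by
    rw [← mul_aeval_mul_swap, ← mul_assoc, hx, zero_mul]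
  have hd : x * (aeval (x * y) d * (x * y)) = 0 := by
    rw [← mul_assoc (aeval (x * y) d), ← mul_aeval_mul_swap, ← mul_assoc, ← mul_assoc, hx,
      zero_mul, zero_mul]
  have hb : x * (aeval (y * x) b * y) = aeval (x * y) b * (x * y) := by
    rw [← mul_assoc, mul_aeval_mul_swap, mul_assoc]
  have he : x * (aeval (y * x) e * (y * x)) = aeval (x * y) (e * X) * x := by
    rw [← mul_assoc, mul_aeval_mul_swap, map_mul, aeval_X, mul_assoc, mul_assoc, mul_assoc]
  simp only [alternatingForm, mul_add, ha, hb, hd, he, ← Algebra.commutes c x]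
  simp [add_mul]
  abel

theorem mul_alternatingForm_right {y : A} (hy : y * y = 0) (x : A) (c : R) (a b d e : R[X]) :
    y * alternatingForm x y c a b d e = alternatingForm x y 0 0 (C c + d * X) 0 a := by
  rw [← alternatingForm_swap, mul_alternatingForm_left hy, alternatingForm_swap]

theorem exists_lift_mul_eq_alternatingForm {g : Fin 2 → A} (h0 : g 0 * g 0 = 0)
    (h1 : g 1 * g 1 = 0) (u : FreeAlgebra R (Fin 2)) :
    ∀ (c : R) (a b d e : R[X]), ∃ (c' : R) (a' b' d' e' : R[X]),
      FreeAlgebra.lift R g u * alternatingForm (g 0) (g 1) c a b d e =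
        alternatingForm (g 0) (g 1) c' a' b' d' e' := by
  induction u using FreeAlgebra.induction with
  | grade0 r =>
    intro c a b d e
    exact ⟨_, _, _, _, _, by rw [AlgHom.commutes, ← alternatingForm_C_mul]⟩
  | grade1 i =>
    intro c a b d e
    rw [FreeAlgebra.lift_ι_apply]
    fin_cases i
    · exact ⟨_, _, _, _, _, mul_alternatingForm_left h0 _ _ _ _ _ _⟩
    · exact ⟨_, _, _, _, _, mul_alternatingForm_right h1 _ _ _ _ _ _⟩
  | mul u v hu hv =>
    intro c a b d e
    obtain ⟨c', a', b', d', e', h⟩ := hv c a b d e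
    rw [map_mul, mul_assoc, h]
    exact hu c' a' b' d' e'
  | add u v hu hv =>
    intro c a b d e
    obtain ⟨c₁, a₁, b₁, d₁, e₁, h₁⟩ := hu c a b d e
    obtain ⟨c₂, a₂, b₂, d₂, e₂, h₂⟩ := hv c a b d e
    rw [map_add, add_mul, h₁, h₂, ← alternatingForm_add]
    exact ⟨_, _, _, _, _, rfl⟩

theorem exists_lift_eq_alternatingForm {g : Fin 2 → A} (h0 : g 0 * g 0 = 0)
    (h1 : g 1 * g 1 = 0) (u : FreeAlgebra R (Fin 2)) :
    ∃ (c : R) (a b d e : R[X]),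
      FreeAlgebra.lift R g u = alternatingForm (g 0) (g 1) c a b d e := by
  simpa [alternatingForm] using exists_lift_mul_eq_alternatingForm h0 h1 u 1 0 0 0 0

theorem map_alternatingForm {B : Type*} [Ring B] [Algebra R B] (f : A →ₐ[R] B) (x y : A)
    (c : R) (a b d e : R[X]) :
    f (alternatingForm x y c a b d e) = alternatingForm (f x) (f y) c a b d e := by
  simp only [alternatingForm, map_add, map_mul, AlgHom.commutes, ← aeval_algHom_apply]

end AlternatingForm

section MatrixModel

open Polynomial Matrix

variable (R : Type*) [CommRing R]

/-- The square-zero matrices `E₁₂` and `X E₂₁` over `R[X]`. -/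
noncomputable def sqZeroMatrix : Fin 2 → Matrix (Fin 2) (Fin 2) R[X] :=
  ![!![0, 1; 0, 0], !![0, 0; X, 0]]

variable {R}

theorem sqZeroMatrix_mul_self (i : Fin 2) : sqZeroMatrix R i * sqZeroMatrix R i = 0 := by
  ext j k
  fin_cases i <;> fin_cases j <;> fin_cases k <;> simp [sqZeroMatrix]

theorem aeval_diagonal_polynomial (v : Fin 2 → R[X]) (a : R[X]) :
    aeval (diagonal v) a = diagonal fun i => aeval (v i) a := by
  have h := aeval_algHom_apply (diagonalAlgHom (n := Fin 2) (α := R[X]) R) v a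
  simp only [diagonalAlgHom_apply] at h
  rw [h]
  congr 1
  funext i
  exact (aeval_algHom_apply (Pi.evalAlgHom R (fun _ : Fin 2 => R[X]) i) v a).symm

theorem alternatingForm_sqZeroMatrix (c : R) (a b d e : R[X]) :
    alternatingForm (sqZeroMatrix R 0) (sqZeroMatrix R 1) c a b d e =
      !![C c + d * X, a; b * X, C c + e * X] := by
  have h01 : sqZeroMatrix R 0 * sqZeroMatrix R 1 = diagonal ![X, 0] := by
    ext i j
    fin_cases i <;> fin_cases j <;> simp [sqZeroMatrix]
  have h10 : sqZeroMatrix R 1 * sqZeroMatrix R 0 = diagonal ![0, X] := by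
    ext i j
    fin_cases i <;> fin_cases j <;> simp [sqZeroMatrix]
  rw [alternatingForm, h01, h10]
  simp only [aeval_diagonal_polynomial]
  ext1 i j
  fin_cases i <;> fin_cases j <;>
    simp [sqZeroMatrix, algebraMap_matrix_apply, diagonal_mul]

theorem alternatingForm_eq_zero_of_sqZeroMatrix {A : Type*} [Ring A] [Algebra R A] (x y : A)
    {c : R} {a b d e : R[X]}
    (h : alternatingForm (sqZeroMatrix R 0) (sqZeroMatrix R 1) c a b d e = 0) :
    alternatingForm x y c a b d e = 0 := by
  rw [alternatingForm_sqZeroMatrix] at h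
  have h00 : C c + d * X = 0 := by simpa using congr_fun₂ h 0 0
  have h01 : a = 0 := by simpa using congr_fun₂ h 0 1
  have h10 : b * X = 0 := by simpa using congr_fun₂ h 1 0
  have h11 : C c + e * X = 0 := by simpa using congr_fun₂ h 1 1
  have hc : c = 0 := by simpa using congr_arg (coeff · 0) h00
  have cancel : ∀ {q : R[X]}, q * X = 0 → q = 0 := fun hq =>
    isRegular_X.right (by simpa using hq)
  subst hc
  simp only [map_zero, zero_add] at h00 h11
  simp [alternatingForm, h01, cancel h00, cancel h10, cancel h11]

/-- The representation of `R⟨x, y⟩/(x², y²)` sending `x` to `E₁₂` and `y` to `X E₂₁`. -/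
noncomputable def sqRelToMatrix :
    RingQuot (sqRel R) →ₐ[R] Matrix (Fin 2) (Fin 2) R[X] :=
  RingQuot.liftAlgHom R ⟨FreeAlgebra.lift R (sqZeroMatrix R), by
    rintro _ _ (⟨rfl, rfl⟩ | ⟨rfl, rfl⟩) <;>
      simp [sq, sqZeroMatrix_mul_self]⟩

theorem sqRelToMatrix_injective : Function.Injective (sqRelToMatrix (R := R)) := by
  rw [injective_iff_map_eq_zero]
  intro u hu
  obtain ⟨v, rfl⟩ := RingQuot.mkAlgHom_surjective R (sqRel R) u
  let g : Fin 2 → RingQuot (sqRel R) :=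
    fun i => RingQuot.mkAlgHom R (sqRel R) (FreeAlgebra.ι R i)
  have hg0 : g 0 * g 0 = 0 := by
    have := RingQuot.mkAlgHom_rel R (s := sqRel R) (Or.inl ⟨rfl, rfl⟩)
    simpa [sq] using this
  have hg1 : g 1 * g 1 = 0 := by
    have := RingQuot.mkAlgHom_rel R (s := sqRel R) (Or.inr ⟨rfl, rfl⟩)
    simpa [sq] using this
  have hlift : RingQuot.mkAlgHom R (sqRel R) = FreeAlgebra.lift R g := by
    ext i
    simp [g]
  have hmap : ∀ i, sqRelToMatrix (g i) = sqZeroMatrix R i := fun i => by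
    simp [g, sqRelToMatrix]
  obtain ⟨c, a, b, d, e, hv⟩ := exists_lift_eq_alternatingForm hg0 hg1 v
  rw [hlift, hv, map_alternatingForm, hmap, hmap] at hu
  rw [hlift, hv]
  exact alternatingForm_eq_zero_of_sqZeroMatrix _ _ hu

end MatrixModel

section Identities

open Polynomial Matrix

variable {R : Type*} [CommRing R]

theorem map_freeAlgebra_lift {σ A B : Type*} [Ring A] [Algebra R A] [Ring B] [Algebra R B]
    (f : A →ₐ[R] B) (v : σ → A) (p : FreeAlgebra R σ) :
    f (FreeAlgebra.lift R v p) = FreeAlgebra.lift R (fun i => f (v i)) p := by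
  have h : f.comp (FreeAlgebra.lift R v) = FreeAlgebra.lift R fun i => f (v i) := by
    ext i
    simp
  exact DFunLike.congr_fun h p

variable (R) in
/-- The block diagonal embedding of a product of two matrix algebras. -/
def fromBlocksAlgHom (m n : Type*) [Fintype m] [Fintype n] [DecidableEq m] [DecidableEq n] :
    Matrix m m R × Matrix n n R →ₐ[R] Matrix (m ⊕ n) (m ⊕ n) R :=
  AlgHom.ofLinearMap
    { toFun := fun M => fromBlocks M.1 0 0 M.2
      map_add' := fun M N => by simp [fromBlocks_add]
      map_smul' := fun r M => by simp [fromBlocks_smul] }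
    (by simp) (fun M N => by simp [fromBlocks_multiply])

theorem matrix_identity_of_le {σ : Type*} {m n : ℕ} (hmn : m ≤ n) (p : FreeAlgebra R σ)
    (hp : ∀ M : σ → Matrix (Fin n) (Fin n) R, FreeAlgebra.lift R M p = 0)
    (M : σ → Matrix (Fin m) (Fin m) R) : FreeAlgebra.lift R M p = 0 := by
  obtain ⟨l, rfl⟩ := Nat.exists_eq_add_of_le hmn
  let N : σ → Matrix (Fin m) (Fin m) R × Matrix (Fin l) (Fin l) R := fun i => (M i, 0)
  let f := (reindexAlgEquiv R R (finSumFinEquiv (m := m) (n := l))).toAlgHom.comp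
    (fromBlocksAlgHom R (Fin m) (Fin l))
  have h : f (FreeAlgebra.lift R N p) = 0 := by rw [map_freeAlgebra_lift, hp]
  have h' : fromBlocks (FreeAlgebra.lift R N p).1 0 0 (FreeAlgebra.lift R N p).2 = 0 :=
    (map_eq_zero_iff _ (reindexAlgEquiv R R finSumFinEquiv).injective).1 h
  rw [← fromBlocks_zero, fromBlocks_inj] at h'
  rw [← h'.1]
  exact (map_freeAlgebra_lift (AlgHom.fst R _ _) N p).symm

theorem polynomial_matrix_identity [IsDomain R] [Infinite R] {σ n : Type*} [Fintype n]
    [DecidableEq n] (p : FreeAlgebra R σ)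
    (hp : ∀ M : σ → Matrix n n R, FreeAlgebra.lift R M p = 0) (M : σ → Matrix n n R[X]) :
    FreeAlgebra.lift R M p = 0 := by
  ext1 i j
  refine Polynomial.funext fun r => ?_
  have h := map_freeAlgebra_lift ((aeval r : R[X] →ₐ[R] R).mapMatrix (m := n)) M p
  rw [hp] at h
  simpa using congr_fun₂ h i j

end Identities

/-- **Proposition.** Let `R` be an infinite commutative domain and
`F = R⟨x, y⟩/(x², y²)`.  Then every polynomial identity of `M_n(R)` (`n ≥ 2`) in `k`
noncommuting variables is a polynomial identity of `F`. -/
theorem quotient_algebra_satisfies_matrix_identities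
    {R : Type*} [CommRing R] [IsDomain R] [Infinite R]
    (n : ℕ) (hn : 2 ≤ n) (k : ℕ) (p : FreeAlgebra R (Fin k))
    (hp : ∀ M : Fin k → Matrix (Fin n) (Fin n) R, (FreeAlgebra.lift R M) p = 0) :
    ∀ u : Fin k → RingQuot (sqRel R), (FreeAlgebra.lift R u) p = 0 := by
  intro u
  apply sqRelToMatrix_injective
  rw [map_zero, map_freeAlgebra_lift]
  exact polynomial_matrix_identity p (matrix_identity_of_le hn p hp) _
end

section
/- Let R be an infinite commutative domain and F = R⟨x, y⟩/(x², y²). Then the unit group U(F) satisfies neither the standard polynomial S₂ nor the standard polynomial S₃: there exist units u, v ∈ U(F) with S₂(u, v) = uv − vu ≠ 0, and there exist units u₁, u₂, u₃ ∈ U(F) with S₃(u₁, u₂, u₃) ≠ 0. (Indeed one may take the units 1 + x̄, 1 + ȳ, and (1 + x̄)(1 + ȳ).) -/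
open scoped BigOperators

/-- The standard polynomial of degree `k`, evaluated at `x₁, …, x_k`:
`S_k(x₁,…,x_k) = ∑_{σ ∈ Sym(k)} sgn(σ) · x_{σ(1)} ⋯ x_{σ(k)}`. -/
noncomputable def stdPoly {A : Type*} [Ring A] (k : ℕ) (x : Fin k → A) : A :=
  ∑ σ : Equiv.Perm (Fin k), (Equiv.Perm.sign σ : ℤ) • (List.ofFn fun i => x (σ i)).prod

open Equiv in
/-- The standard polynomial of degree three, written out. -/
theorem stdPoly_three {A : Type*} [Ring A] (x : Fin 3 → A) :
    stdPoly 3 x = x 0 * x 1 * x 2 - x 1 * x 0 * x 2 - x 2 * x 1 * x 0 - x 0 * x 2 * x 1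
      + x 1 * x 2 * x 0 + x 2 * x 0 * x 1 := by
  have huniv : (Finset.univ : Finset (Perm (Fin 3))) =
      {1, swap 0 1, swap 0 2, swap 1 2, swap 0 1 * swap 1 2, swap 1 2 * swap 0 1} := by
    decide
  have h1 : swap (0 : Fin 3) 1 2 = 2 := by decide
  have h2 : swap (0 : Fin 3) 2 1 = 1 := by decide
  have h3 : swap (1 : Fin 3) 2 0 = 0 := by decide
  unfold stdPoly
  rw [huniv, Finset.sum_insert (by decide), Finset.sum_insert (by decide),
    Finset.sum_insert (by decide), Finset.sum_insert (by decide),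
    Finset.sum_insert (by decide), Finset.sum_singleton]
  simp [List.ofFn_succ, h1, h2, h3, mul_assoc]
  abel

/-- The unit `1 + a` attached to an element `a` of square zero. -/
def oneAddUnit {A : Type*} [Ring A] (a : A) (ha : a * a = 0) : Aˣ where
  val := 1 + a
  inv := 1 - a
  val_inv := by simp [mul_sub, add_mul, ha]
  inv_val := by simp [mul_add, sub_mul, ha]

/-- The image of the `i`-th generator in `R⟨x, y⟩/(x², y²)`. -/
noncomputable def sqGen (R : Type*) [CommRing R] (i : Fin 2) : RingQuot (sqRel R) :=
  RingQuot.mkAlgHom R (sqRel R) (FreeAlgebra.ι R i)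

theorem sqGen_mul_self (R : Type*) [CommRing R] (i : Fin 2) :
    sqGen R i * sqGen R i = 0 := by
  have h : sqRel R (FreeAlgebra.ι R i ^ 2) 0 := by
    fin_cases i
    · exact Or.inl ⟨rfl, rfl⟩
    · exact Or.inr ⟨rfl, rfl⟩
  simpa [sqGen, sq] using RingQuot.mkAlgHom_rel R h

/-- The representation of `R⟨x, y⟩/(x², y²)` on `R²` sending `x` and `y` to the two
off-diagonal matrix units. -/
noncomputable def sqRep (R : Type*) [CommRing R] :
    RingQuot (sqRel R) →ₐ[R] Matrix (Fin 2) (Fin 2) R :=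
  RingQuot.liftAlgHom R ⟨FreeAlgebra.lift R ![!![0, 1; 0, 0], !![0, 0; 1, 0]], by
    rintro a b (⟨rfl, rfl⟩ | ⟨rfl, rfl⟩)
    · simp [sq, ← Matrix.ext_iff, Fin.forall_fin_two]
    · simp [sq, ← Matrix.ext_iff, Fin.forall_fin_two]⟩

theorem sqRep_sqGen_zero (R : Type*) [CommRing R] :
    sqRep R (sqGen R 0) = !![0, 1; 0, 0] := by
  simp [sqRep, sqGen]

theorem sqRep_sqGen_one (R : Type*) [CommRing R] :
    sqRep R (sqGen R 1) = !![0, 0; 1, 0] := by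
  simp [sqRep, sqGen]

/-- Let `R` be an infinite commutative domain and `F = R⟨x, y⟩/(x², y²)`.  The unit
group `U(F)` satisfies neither the standard polynomial `S₂` nor `S₃`: there are
units `u, v` with `uv - vu ≠ 0`, and units `u₁, u₂, u₃` with `S₃(u₁,u₂,u₃) ≠ 0`. -/
theorem units_of_quotient_fail_S2_S3
    {R : Type*} [CommRing R] [IsDomain R] [Infinite R] :
    (∃ u v : (RingQuot (sqRel R))ˣ,
        (u : RingQuot (sqRel R)) * v - (v : RingQuot (sqRel R)) * u ≠ 0) ∧
    (∃ u : Fin 3 → (RingQuot (sqRel R))ˣ,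
        stdPoly 3 (fun i => ((u i : (RingQuot (sqRel R))ˣ) : RingQuot (sqRel R))) ≠ 0) := by
  let u := oneAddUnit (sqGen R 0) (sqGen_mul_self R 0)
  let v := oneAddUnit (sqGen R 1) (sqGen_mul_self R 1)
  have hu : sqRep R (u : RingQuot (sqRel R)) = !![1, 1; 0, 1] := by
    simp [u, oneAddUnit, sqRep_sqGen_zero, Matrix.one_fin_two]
  have hv : sqRep R (v : RingQuot (sqRel R)) = !![1, 0; 1, 1] := by
    simp [v, oneAddUnit, sqRep_sqGen_one, Matrix.one_fin_two]
  refine ⟨⟨u, v, fun h => ?_⟩, ⟨![u, v, u * v], fun h => ?_⟩⟩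
  · have h00 := congrFun (congrFun (congrArg (sqRep R) h) 0) 0
    simp [hu, hv] at h00
  · rw [stdPoly_three] at h
    have h00 := congrFun (congrFun (congrArg (sqRep R) h) 0) 0
    simp [hu, hv] at h00
    ring_nf at h00
    simp at h00
end

section
/- Let R be a commutative domain and B an associative unital R-algebra whose unit group U(B) satisfies the standard polynomial S₃, i.e. S₃(u₁, u₂, u₃) = 0 for all units u₁, u₂, u₃ ∈ U(B). Then there exists a nonzero polynomial g ∈ R[X] such that g(ab) = 0 for all a, b ∈ B with a² = 0 and b² = 0. -/
open scoped BigOperators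

/-- Substituting `1` for the first variable of `S₃` gives the commutator. -/
theorem stdPoly_three_one {A : Type*} [Ring A] (x y : A) :
    stdPoly 3 ![1, x, y] = x * y - y * x := by
  have h : (Finset.univ : Finset (Equiv.Perm (Fin 3))) =
      {1, Equiv.swap 0 1, Equiv.swap 0 2, Equiv.swap 1 2,
        Equiv.swap 0 1 * Equiv.swap 1 2, Equiv.swap 1 2 * Equiv.swap 0 1} := by
    decide
  unfold stdPoly
  rw [h]
  repeat rw [Finset.sum_insert (by decide)]
  rw [Finset.sum_singleton]
  simp [List.ofFn_succ, Equiv.swap_apply_def, Equiv.Perm.sign_swap']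
  abel

/-- **Corollary.** Let `B` be an algebra over a commutative domain `R` whose unit
group satisfies the standard polynomial `S₃`.  Then there is a nonzero polynomial
`g ∈ R[X]` such that `g(ab) = 0` for all `a, b ∈ B` with `a² = b² = 0`. -/
theorem units_S3_annihilating_poly
    {R : Type*} [CommRing R] [IsDomain R] {B : Type*} [Ring B] [Algebra R B]
    (hS3 : ∀ u : Fin 3 → Bˣ, stdPoly 3 (fun i => ((u i : Bˣ) : B)) = 0) :
    ∃ g : Polynomial R, g ≠ 0 ∧
      ∀ a b : B, a ^ 2 = 0 → b ^ 2 = 0 → Polynomial.aeval (a * b) g = 0 := by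
  have units_commute (u v : Bˣ) : Commute (u : B) v := by
    have h : (fun i => ((![1, u, v] i : Bˣ) : B)) = ![1, (u : B), (v : B)] := by
      ext i
      fin_cases i <;> rfl
    have huv := hS3 ![1, u, v]
    rw [h, stdPoly_three_one] at huv
    exact sub_eq_zero.mp huv
  refine ⟨Polynomial.X ^ 2, pow_ne_zero 2 Polynomial.X_ne_zero, fun a b ha hb => ?_⟩
  obtain ⟨u, hu⟩ := IsNilpotent.isUnit_one_add ⟨2, ha⟩
  obtain ⟨v, hv⟩ := IsNilpotent.isUnit_one_add ⟨2, hb⟩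
  have hab : Commute a b := by
    have h := units_commute u v
    rw [hu, hv] at h
    simpa using (h.sub_left (Commute.one_left _)).sub_right (Commute.one_right _)
  rw [map_pow, Polynomial.aeval_X, hab.mul_pow, ha, zero_mul]
end
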